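/- Boundary identity for the Diagonal Expression Lemma: let λ be a Young diagram with at most d rows, let i, j ∈ [d], and assume λ + e_i is again a Young diagram, i.e. i = 1 or λ_{i−1} > λ_i. Then ∑_{(k,ℓ) ∈ [d]², max(k,ℓ) = d} (λ↑↑_k · λ↑↑_ℓ + (1/Δ) · λ↑↑_d) · g(k, ℓ) = (C_i + 1)(C^{λ+e_i}_j + 1) · D_{d→ij} − (C_i + 2)(C^{λ+e_i}_j + 2) · D_{d−1→ij}. -/

import Mathlib

open Finset

/-- The Weyl dimension polynomial `WD_p(mu) = prod_{1 <= a < b <= p} ((mu_a - mu_b) + (b - a))/(b - a)`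
of the integer tuple `(mu 1, ..., mu p)`. -/
def weylDim (p : ℕ) (μ : ℕ → ℤ) : ℚ :=
  ∏ a ∈ Finset.Icc 1 p, ∏ b ∈ Finset.Icc (a + 1) p,
    (((μ a : ℚ) - (μ b : ℚ)) + ((b : ℚ) - (a : ℚ))) / ((b : ℚ) - (a : ℚ))

/-- `addBox μ y = μ + e_y`: the tuple `μ` with `1` added in coordinate `y`. -/
def addBox (μ : ℕ → ℤ) (y : ℕ) : ℕ → ℤ := fun x => μ x + if x = y then 1 else 0

/-- The dimension ratio `D^μ_{k→y} = WD_k(μ + e_y)/WD_k(μ)` for `y ≤ k`, and `0` for `k < y`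
(division by zero evaluates to `0`). -/
def dimRatio (μ : ℕ → ℤ) (k y : ℕ) : ℚ :=
  if y ≤ k then weylDim k (addBox μ y) / weylDim k μ else 0

def intOf (lam : ℕ → ℕ) : ℕ → ℤ := fun x => (lam x : ℤ)

/-- `Δ = (λ_j − λ_i) + (i − j) + δ_{ij}`. -/
def Del (lam : ℕ → ℕ) (i j : ℕ) : ℚ :=
  (((lam j : ℚ) - (lam i : ℚ)) + ((i : ℚ) - (j : ℚ))) + (if i = j then 1 else 0)

/-- The partial-sum function `F(s, t)` of squared two-step Clebsch–Gordan coefficients. -/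
def Fcoef (lam : ℕ → ℕ) (i j : ℕ) (s t : ℕ) : ℚ :=
  if s ≤ t then dimRatio (intOf lam) s i * dimRatio (addBox (intOf lam) i) t j
  else
    dimRatio (intOf lam) t j * dimRatio (addBox (intOf lam) j) s i
      + 1 / Del lam i j ^ 2 *
          (dimRatio (intOf lam) t i * dimRatio (addBox (intOf lam) i) s j
            - dimRatio (intOf lam) t j * dimRatio (addBox (intOf lam) j) s i)

/-- The squared two-step Clebsch–Gordan coefficient `g(k, ℓ)`. -/
def gcoef (lam : ℕ → ℕ) (i j : ℕ) (k l : ℕ) : ℚ :=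
  Fcoef lam i j k l - Fcoef lam i j (k - 1) l - Fcoef lam i j k (l - 1)
    + Fcoef lam i j (k - 1) (l - 1)

/-- `D_{s→ij}`. -/
def dimR2 (lam : ℕ → ℕ) (i j s : ℕ) : ℚ :=
  if max i j ≤ s then weylDim s (addBox (addBox (intOf lam) i) j) / weylDim s (intOf lam)
  else 0

/-- `C^{λ+e_i}_j = λ_j + δ_{ij} − j`. -/
def rowContentAdd (lam : ℕ → ℕ) (i j : ℕ) : ℚ :=
  ((lam j : ℚ) + (if i = j then 1 else 0)) - (j : ℚ)

/-- The content `C_x = λ_x − x` of row `x`. -/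
def rowContent (lam : ℕ → ℕ) (x : ℕ) : ℚ := (lam x : ℚ) - (x : ℚ)

/-- The staircase transformation `λ↑↑_k = λ_k + d − 2k + 1`. -/
def staircase (d : ℕ) (lam : ℕ → ℕ) (k : ℕ) : ℤ :=
  (lam k : ℤ) + (d : ℤ) - 2 * (k : ℤ) + 1

theorem weylDim_eq_zero_iff (p : ℕ) (μ : ℕ → ℤ) :
    weylDim p μ = 0 ↔ ∃ a b : ℕ, 1 ≤ a ∧ a < b ∧ b ≤ p ∧ μ a - a = μ b - b := by
  unfold weylDim
  simp only [Finset.prod_eq_zero_iff, Finset.mem_Icc, div_eq_zero_iff]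
  constructor
  · rintro ⟨a, ⟨ha, -⟩, b, ⟨hab, hb⟩, h | h⟩
    · refine ⟨a, b, ha, hab, hb, ?_⟩
      have : ((μ a - a : ℤ) : ℚ) = (μ b - b : ℤ) := by push_cast; linarith
      exact_mod_cast this
    · have : (b : ℚ) = a := by linarith
      have : b = a := by exact_mod_cast this
      omega
  · rintro ⟨a, b, ha, hab, hb, h⟩
    refine ⟨a, ⟨ha, by omega⟩, b, ⟨hab, hb⟩, Or.inl ?_⟩
    have : ((μ a - a : ℤ) : ℚ) = (μ b - b : ℤ) := by rw [h]
    push_cast at this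
    linarith

theorem weylDim_succ (p : ℕ) (μ : ℕ → ℤ) :
    weylDim (p + 1) μ = weylDim p μ * ∏ a ∈ Finset.Icc 1 p,
      (((μ a : ℚ) - μ (p + 1)) + (((p + 1 : ℕ) : ℚ) - a)) / (((p + 1 : ℕ) : ℚ) - a) := by
  unfold weylDim
  rw [Finset.prod_Icc_succ_top (by omega), Finset.Icc_eq_empty (a := p + 1 + 1) (by omega),
    Finset.prod_empty, mul_one, ← Finset.prod_mul_distrib]
  refine Finset.prod_congr rfl fun a ha => ?_
  rw [Finset.mem_Icc] at ha
  rw [Finset.prod_Icc_succ_top (by omega)]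

theorem dimRatio_of_lt {μ : ℕ → ℤ} {k y : ℕ} (h : k < y) : dimRatio μ k y = 0 :=
  if_neg (by omega)

theorem dimRatio_succ {μ : ℕ → ℤ} {p y : ℕ} (hy : 1 ≤ y) (hyp : y ≤ p)
    (hμ : ∀ a, 1 ≤ a → a ≤ p → μ a - a ≠ μ (p + 1) - (p + 1 : ℕ)) :
    dimRatio μ (p + 1) y * (((μ y : ℚ) - y) - (μ (p + 1) - (p + 1 : ℕ)))
      = dimRatio μ p y * (((μ y : ℚ) - y) - (μ (p + 1) - (p + 1 : ℕ)) + 1) := by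
  have hne : ∀ a ∈ Finset.Icc 1 p, ((μ a : ℚ) - μ (p + 1)) + (((p + 1 : ℕ) : ℚ) - a) ≠ 0 := by
    intro a ha h
    rw [Finset.mem_Icc] at ha
    apply hμ a ha.1 ha.2
    have : ((μ a - a : ℤ) : ℚ) = (μ (p + 1) - (p + 1 : ℕ) : ℤ) := by
      push_cast at h ⊢; linarith
    exact_mod_cast this
  have hden : ∀ a ∈ Finset.Icc 1 p, ((p + 1 : ℕ) : ℚ) - a ≠ 0 := by
    intro a ha h
    rw [Finset.mem_Icc] at ha
    have : ((p + 1 : ℕ) : ℚ) = a := by linarith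
    have : p + 1 = a := by exact_mod_cast this
    omega
  have hmem : y ∈ Finset.Icc 1 p := Finset.mem_Icc.2 ⟨hy, hyp⟩
  have hprod : (∏ a ∈ Finset.Icc 1 p, (((addBox μ y a : ℚ) - addBox μ y (p + 1))
        + (((p + 1 : ℕ) : ℚ) - a)) / (((p + 1 : ℕ) : ℚ) - a))
        * (((μ y : ℚ) - y) - (μ (p + 1) - (p + 1 : ℕ)))
      = (∏ a ∈ Finset.Icc 1 p, (((μ a : ℚ) - μ (p + 1)) + (((p + 1 : ℕ) : ℚ) - a))
          / (((p + 1 : ℕ) : ℚ) - a)) * (((μ y : ℚ) - y) - (μ (p + 1) - (p + 1 : ℕ)) + 1) := by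
    rw [← Finset.mul_prod_erase _ _ hmem, ← Finset.mul_prod_erase _ _ hmem]
    have hrest : ∏ a ∈ (Finset.Icc 1 p).erase y, (((addBox μ y a : ℚ) - addBox μ y (p + 1))
        + (((p + 1 : ℕ) : ℚ) - a)) / (((p + 1 : ℕ) : ℚ) - a)
        = ∏ a ∈ (Finset.Icc 1 p).erase y, (((μ a : ℚ) - μ (p + 1)) + (((p + 1 : ℕ) : ℚ) - a))
          / (((p + 1 : ℕ) : ℚ) - a) := by
      refine Finset.prod_congr rfl fun a ha => ?_
      simp [addBox, Finset.ne_of_mem_erase ha, show p + 1 ≠ y by omega]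
    rw [hrest]
    simp only [addBox, if_true, if_neg (show p + 1 ≠ y by omega)]
    push_cast
    ring
  have hprod0 : (∏ a ∈ Finset.Icc 1 p, (((μ a : ℚ) - μ (p + 1)) + (((p + 1 : ℕ) : ℚ) - a))
          / (((p + 1 : ℕ) : ℚ) - a)) ≠ 0 :=
    Finset.prod_ne_zero_iff.2 fun a ha => div_ne_zero (hne a ha) (hden a ha)
  rw [dimRatio, dimRatio, if_pos (by omega), if_pos hyp, weylDim_succ, weylDim_succ,
    mul_div_mul_comm, mul_assoc, div_mul_eq_mul_div _ _ (_ - _), hprod, mul_div_right_comm,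
    div_self hprod0, one_mul]

/-- Closed form of a weighted sum of increments of a dimension ratio. -/
theorem sum_weighted_increments (x A : ℕ → ℚ) (z c : ℚ) (d : ℕ) (h0 : A 0 = 0)
    (hA : ∀ k, k + 1 ≤ d → (z - x (k + 1)) * (A (k + 1) - A k) = A k) (s : ℕ) (hs : s ≤ d) :
    ∑ k ∈ Finset.range s, (x (k + 1) - (k + 1 : ℕ) + c) * (A (k + 1) - A k)
      = (z - s + c) * A s := by
  induction s with
  | zero => simp [h0]
  | succ s ih =>
    rw [Finset.sum_range_succ, ih (by omega)]
    have := hA s hs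
    push_cast
    linear_combination -this

theorem sum_filter_max_eq (n : ℕ) (f : ℕ × ℕ → ℚ) :
    ∑ p ∈ (Finset.Icc 1 (n + 1) ×ˢ Finset.Icc 1 (n + 1)).filter (fun p => max p.1 p.2 = n + 1), f p
      = ∑ k ∈ Finset.range n, f (k + 1, n + 1) + ∑ l ∈ Finset.range n, f (n + 1, l + 1)
        + f (n + 1, n + 1) := by
  have key : ∀ g : ℕ → ℚ, ∑ k ∈ Finset.Icc 1 (n + 1), g k
      = ∑ k ∈ Finset.range n, g (k + 1) + g (n + 1) := by
    intro g
    rw [← Finset.sum_range_succ (fun k => g (k + 1)), Finset.range_eq_Ico,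
      Finset.sum_Ico_add' g 0 (n + 1) 1]
    rfl
  have h1 : ∀ k ∈ Finset.range n, ∀ l ∈ Finset.range n,
      (if max (k + 1) (l + 1) = n + 1 then f (k + 1, l + 1) else 0) = 0 := by
    intro k hk l hl
    rw [Finset.mem_range] at hk hl
    exact if_neg (by omega)
  have h2 : ∀ k ∈ Finset.range n,
      (if max (k + 1) (n + 1) = n + 1 then f (k + 1, n + 1) else 0) = f (k + 1, n + 1) := by
    intro k hk
    rw [Finset.mem_range] at hk
    exact if_pos (by omega)
  have h3 : ∀ k ∈ Finset.range n,
      (if max (n + 1) (k + 1) = n + 1 then f (n + 1, k + 1) else 0) = f (n + 1, k + 1) := by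
    intro k hk
    rw [Finset.mem_range] at hk
    exact if_pos (by omega)
  rw [Finset.sum_filter, Finset.sum_product, key]
  simp only [key]
  rw [Finset.sum_congr rfl h3, Finset.sum_add_distrib, Finset.sum_congr rfl h2,
    Finset.sum_eq_zero fun k hk => Finset.sum_eq_zero (h1 k hk)]
  simp only [max_self, if_true]
  ring

theorem row_antitone {d : ℕ} {lam : ℕ → ℕ}
    (hlam : ∀ k, 1 ≤ k → k + 1 ≤ d → lam (k + 1) ≤ lam k) {a b : ℕ}
    (ha : 1 ≤ a) (hab : a ≤ b) (hb : b ≤ d) : lam b ≤ lam a := by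
  induction b, hab using Nat.le_induction with
  | base => exact le_rfl
  | succ b hab ih => exact (hlam b (by omega) hb).trans (ih (by omega))

theorem weylDim_addBox_ne_zero {d : ℕ} {lam : ℕ → ℕ}
    (hlam : ∀ k, 1 ≤ k → k + 1 ≤ d → lam (k + 1) ≤ lam k) {i : ℕ} (hid : i ≤ d)
    (hvalid : i = 1 ∨ lam i < lam (i - 1)) {t : ℕ} (ht : t ≤ d) :
    weylDim t (addBox (intOf lam) i) ≠ 0 := by
  rw [Ne, weylDim_eq_zero_iff]
  rintro ⟨a, b, ha, hab, hb, h⟩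
  have h1 := row_antitone hlam ha hab.le (hb.trans ht)
  simp only [addBox, intOf] at h
  by_cases hbi : b = i
  · subst hbi
    rw [if_neg (by omega), if_pos rfl] at h
    have h2 := row_antitone hlam ha (show a ≤ b - 1 by omega) (by omega)
    omega
  · rw [if_neg hbi] at h
    split_ifs at h <;> omega

theorem dimRatio_mul_dimRatio {lam : ℕ → ℕ} {i j t : ℕ}
    (h : weylDim t (addBox (intOf lam) i) ≠ 0) :
    dimRatio (intOf lam) t i * dimRatio (addBox (intOf lam) i) t j = dimR2 lam i j t := by
  unfold dimRatio dimR2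
  by_cases hit : i ≤ t <;> by_cases hjt : j ≤ t <;> simp [hit, hjt]
  field_simp

theorem dimR2_comm (lam : ℕ → ℕ) (i j t : ℕ) : dimR2 lam i j t = dimR2 lam j i t := by
  have : addBox (addBox (intOf lam) i) j = addBox (addBox (intOf lam) j) i := by
    funext x; simp only [addBox]; ring
  rw [dimR2, dimR2, this, max_comm]

theorem exchange_dimRatio {d : ℕ} {lam : ℕ → ℕ}
    (hlam : ∀ k, 1 ≤ k → k + 1 ≤ d → lam (k + 1) ≤ lam k) {i j t : ℕ} (ht : t ≤ d) :
    (1 - 1 / Del lam i j ^ 2) * (dimRatio (intOf lam) t j * dimRatio (addBox (intOf lam) j) t i)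
      = (1 - 1 / Del lam i j ^ 2) * dimR2 lam i j t := by
  by_cases hij : i = j
  · simp [Del, hij]
  by_cases h : weylDim t (addBox (intOf lam) j) = 0
  · by_cases hm : max i j ≤ t
    · rw [dimRatio, if_pos (by omega), h, zero_div, zero_mul, mul_zero, dimR2, if_pos hm]
      rw [weylDim_eq_zero_iff] at h
      obtain ⟨a, b, ha, hab, hb, h⟩ := h
      have h1 := row_antitone hlam ha hab.le (hb.trans ht)
      simp only [addBox, intOf] at h
      have hbj : b = j := by
        by_contra hbj
        rw [if_neg hbj] at h
        split_ifs at h <;> omega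
      subst hbj
      rw [if_neg (by omega), if_pos rfl] at h
      by_cases hai : a = i
      · subst hai
        have : Del lam a b = -1 := by
          have : ((lam a + 0 - a : ℤ) : ℚ) = (lam b + 1 - b : ℤ) := by rw [h]
          push_cast at this
          rw [Del, if_neg hij]
          linarith
        rw [this]
        norm_num
      · have : weylDim t (addBox (addBox (intOf lam) i) b) = 0 := by
          rw [weylDim_eq_zero_iff]
          refine ⟨a, b, ha, hab, hb, ?_⟩
          simp only [addBox, intOf, if_true]
          rw [if_neg hai, if_neg (by omega), if_neg (Ne.symm hij)]
          omega
        rw [this]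
        simp
    · rw [dimR2, if_neg hm]
      by_cases hit : i ≤ t
      · rw [dimRatio_of_lt (μ := intOf lam) (by omega)]; simp
      · rw [dimRatio_of_lt (μ := addBox (intOf lam) j) (by omega)]; simp
  · rw [dimRatio_mul_dimRatio h, dimR2_comm]

theorem Fcoef_of_le {lam : ℕ → ℕ} {i j s t : ℕ} (h : s ≤ t) :
    Fcoef lam i j s t = dimRatio (intOf lam) s i * dimRatio (addBox (intOf lam) i) t j :=
  if_pos h

theorem Fcoef_of_ge {d : ℕ} {lam : ℕ → ℕ}
    (hlam : ∀ k, 1 ≤ k → k + 1 ≤ d → lam (k + 1) ≤ lam k) {i j : ℕ} (hid : i ≤ d)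
    (hvalid : i = 1 ∨ lam i < lam (i - 1)) {s t : ℕ} (hts : t ≤ s) (hs : s ≤ d) :
    Fcoef lam i j s t = (1 - 1 / Del lam i j ^ 2) *
        (dimRatio (intOf lam) t j * dimRatio (addBox (intOf lam) j) s i)
      + 1 / Del lam i j ^ 2 * (dimRatio (intOf lam) t i * dimRatio (addBox (intOf lam) i) s j) := by
  rcases hts.lt_or_eq with h | rfl
  · rw [Fcoef, if_neg (by omega)]; ring
  · rw [Fcoef_of_le le_rfl, exchange_dimRatio hlam hs,
      dimRatio_mul_dimRatio (weylDim_addBox_ne_zero hlam hid hvalid hs)]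
    ring

theorem dimRatio_increment {d : ℕ} {lam : ℕ → ℕ}
    (hlam : ∀ k, 1 ≤ k → k + 1 ≤ d → lam (k + 1) ≤ lam k) {i : ℕ} (hi : 1 ≤ i) {k : ℕ}
    (hk : k + 1 ≤ d) :
    (rowContent lam i - rowContent lam (k + 1))
        * (dimRatio (intOf lam) (k + 1) i - dimRatio (intOf lam) k i)
      = dimRatio (intOf lam) k i := by
  rcases lt_trichotomy (k + 1) i with h | h | h
  · rw [dimRatio_of_lt h, dimRatio_of_lt (by omega)]; ring
  · rw [dimRatio_of_lt (show k < i by omega), h]; ring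
  · have := dimRatio_succ (μ := intOf lam) hi (show i ≤ k by omega) (by
      intro a ha hak
      have := row_antitone hlam ha (show a ≤ k + 1 by omega) hk
      simp only [intOf]
      omega)
    simp only [intOf, Int.cast_natCast] at this
    rw [rowContent, rowContent]
    linear_combination this

theorem boundary_diagonal_expression
    (d : ℕ) (hd : 1 ≤ d) (lam : ℕ → ℕ)
    (hlam : ∀ k, 1 ≤ k → k + 1 ≤ d → lam (k + 1) ≤ lam k)
    (i j : ℕ) (hi : i ∈ Finset.Icc 1 d) (hj : j ∈ Finset.Icc 1 d)
    (hvalid : i = 1 ∨ lam i < lam (i - 1)) :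
    ∑ p ∈ ((Finset.Icc 1 d ×ˢ Finset.Icc 1 d).filter (fun p => max p.1 p.2 = d)),
        ((staircase d lam p.1 : ℚ) * (staircase d lam p.2 : ℚ)
            + 1 / Del lam i j * (staircase d lam d : ℚ)) * gcoef lam i j p.1 p.2
      = (rowContent lam i + 1) * (rowContentAdd lam i j + 1) * dimR2 lam i j d
        - (rowContent lam i + 2) * (rowContentAdd lam i j + 2) * dimR2 lam i j (d - 1) := by
  rw [Finset.mem_Icc] at hi hj
  obtain ⟨n, rfl⟩ : ∃ n, d = n + 1 := ⟨d - 1, by omega⟩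
  have hR : ∀ t ≤ n + 1, dimRatio (intOf lam) t i * dimRatio (addBox (intOf lam) i) t j
      = dimR2 lam i j t := fun t ht =>
    dimRatio_mul_dimRatio (weylDim_addBox_ne_zero hlam hi.2 hvalid ht)
  have hE : ∀ t ≤ n + 1, _ := fun t ht => exchange_dimRatio hlam (i := i) (j := j) (t := t) ht
  have hFge : ∀ s t, t ≤ s → s ≤ n + 1 → _ := fun s t hts hs =>
    Fcoef_of_ge hlam (j := j) hi.2 hvalid hts hs
  have hAi : ∀ k, k + 1 ≤ n + 1 → _ := fun k hk => dimRatio_increment hlam hi.1 hk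
  have hAj : ∀ k, k + 1 ≤ n + 1 → _ := fun k hk => dimRatio_increment hlam hj.1 hk
  have hFle : ∀ s t, s ≤ t → _ := fun s t h => Fcoef_of_le (lam := lam) (i := i) (j := j) h
  have hAi0 : dimRatio (intOf lam) 0 i = 0 := dimRatio_of_lt hi.1
  have hAj0 : dimRatio (intOf lam) 0 j = 0 := dimRatio_of_lt hj.1
  have hAi_lt : n < i → dimRatio (intOf lam) n i = 0 := dimRatio_of_lt
  have hAj_lt : n < j → dimRatio (intOf lam) n j = 0 := dimRatio_of_lt
  have hB_lt : n < j → dimRatio (addBox (intOf lam) i) n j = 0 := dimRatio_of_lt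
  have hB : i ≤ n → j ≤ n → dimRatio (addBox (intOf lam) i) (n + 1) j
      * (rowContent lam j + (if i = j then 1 else 0) - rowContent lam (n + 1))
      = dimRatio (addBox (intOf lam) i) n j
      * (rowContent lam j + (if i = j then 1 else 0) - rowContent lam (n + 1) + 1) := by
    intro hin hjn
    have := dimRatio_succ (μ := addBox (intOf lam) i) hj.1 hjn (by
      intro a ha han
      have := row_antitone hlam ha (show a ≤ n + 1 by omega) le_rfl
      simp only [addBox, intOf, if_neg (show n + 1 ≠ i by omega)]
      split_ifs <;> omega)
    simp only [addBox, intOf, if_neg (show n + 1 ≠ i by omega), eq_comm (a := j)] at this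
    push_cast at this
    simp only [rowContent]
    push_cast
    linear_combination this
  have hx : ∀ a, 1 ≤ a → a ≤ n → rowContent lam (n + 1) < rowContent lam a := by
    intro a ha han
    have h1 := row_antitone hlam ha (show a ≤ n + 1 by omega) le_rfl
    have h2 : (lam (n + 1) : ℚ) ≤ lam a := by exact_mod_cast h1
    have h3 : (a : ℚ) ≤ n := by exact_mod_cast han
    simp only [rowContent]
    push_cast
    linarith
  have hDel : Del lam i j = rowContent lam j - rowContent lam i + if i = j then 1 else 0 := by
    simp only [Del, rowContent]; ring
  have hDel0 : Del lam i j ≠ 0 := by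
    rw [hDel]
    by_cases hij : i = j
    · simp [hij]
    · rw [if_neg hij, add_zero, sub_ne_zero]
      simp only [rowContent]
      intro h
      have h' : (lam j : ℤ) - j = lam i - i := by exact_mod_cast h
      rcases lt_or_gt_of_ne hij with h1 | h1
      · have := row_antitone hlam hi.1 h1.le hj.2
        omega
      · have := row_antitone hlam hj.1 h1.le hi.2
        omega
  have hC : rowContentAdd lam i j = rowContent lam j + if i = j then 1 else 0 := by
    simp only [rowContentAdd, rowContent]; ring
  have hy : ∀ k, (staircase (n + 1) lam k : ℚ) = rowContent lam k - k + (n + 2) := by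
    intro k
    simp only [staircase, rowContent]
    push_cast
    ring
  have hSi := sum_weighted_increments (rowContent lam) (fun k => dimRatio (intOf lam) k i)
    (rowContent lam i) (n + 2) (n + 1) hAi0 hAi n (by omega)
  have hSj := sum_weighted_increments (rowContent lam) (fun k => dimRatio (intOf lam) k j)
    (rowContent lam j) (n + 2) (n + 1) hAj0 hAj n (by omega)
  have hTi := Finset.sum_range_sub (fun k => dimRatio (intOf lam) k i) n
  have hTj := Finset.sum_range_sub (fun k => dimRatio (intOf lam) k j) n
  have hRn := hR n (by omega)
  have hRd := hR (n + 1) le_rfl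
  have hEn := hE n (by omega)
  have hEd := hE (n + 1) le_rfl
  have hAin := hAi n le_rfl
  have hAjn := hAj n le_rfl
  rw [sum_filter_max_eq, Nat.add_sub_cancel]
  simp only [hy, hC]
  have hg1 : ∀ k ∈ Finset.range n, gcoef lam i j (k + 1) (n + 1)
      = (dimRatio (addBox (intOf lam) i) (n + 1) j - dimRatio (addBox (intOf lam) i) n j)
        * (dimRatio (intOf lam) (k + 1) i - dimRatio (intOf lam) k i) := by
    intro k hk
    rw [Finset.mem_range] at hk
    rw [gcoef, Nat.add_sub_cancel, Nat.add_sub_cancel, hFle _ _ (by omega), hFle _ _ (by omega),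
      hFle _ _ (by omega), hFle _ _ (by omega)]
    ring
  have hg2 : ∀ l ∈ Finset.range n, gcoef lam i j (n + 1) (l + 1)
      = (1 - 1 / Del lam i j ^ 2)
        * (dimRatio (addBox (intOf lam) j) (n + 1) i - dimRatio (addBox (intOf lam) j) n i)
        * (dimRatio (intOf lam) (l + 1) j - dimRatio (intOf lam) l j)
        + 1 / Del lam i j ^ 2
        * (dimRatio (addBox (intOf lam) i) (n + 1) j - dimRatio (addBox (intOf lam) i) n j)
        * (dimRatio (intOf lam) (l + 1) i - dimRatio (intOf lam) l i) := by
    intro l hl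
    rw [Finset.mem_range] at hl
    rw [gcoef, Nat.add_sub_cancel, Nat.add_sub_cancel, hFge _ _ (by omega) (by omega),
      hFge _ _ (by omega) (by omega), hFge _ _ (by omega) (by omega),
      hFge _ _ (by omega) (by omega)]
    ring
  have hg3 : gcoef lam i j (n + 1) (n + 1) = dimR2 lam i j (n + 1)
      - dimRatio (intOf lam) n i * dimRatio (addBox (intOf lam) i) (n + 1) j
      - ((1 - 1 / Del lam i j ^ 2)
          * (dimRatio (intOf lam) n j * dimRatio (addBox (intOf lam) j) (n + 1) i)
        + 1 / Del lam i j ^ 2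
          * (dimRatio (intOf lam) n i * dimRatio (addBox (intOf lam) i) (n + 1) j))
      + dimR2 lam i j n := by
    rw [gcoef, Nat.add_sub_cancel, hFge (n + 1) n (by omega) le_rfl, hFle _ _ le_rfl,
      hFle _ _ (by omega), hFle _ _ le_rfl, hRn, hRd]
  generalize dimR2 lam i j n = Rn at *
  generalize dimR2 lam i j (n + 1) = Rd at *
  generalize hr : 1 / Del lam i j = r at *
  have hr2 : 1 / Del lam i j ^ 2 = r ^ 2 := by rw [← hr]; ring
  rw [hr2] at hg2 hg3 hEn hEd
  have hsumi : ∑ k ∈ Finset.range n, (rowContent lam (k + 1) - (k + 1 : ℕ) + (n + 2) + r)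
        * (dimRatio (intOf lam) (k + 1) i - dimRatio (intOf lam) k i)
      = (rowContent lam i + 2 + r) * dimRatio (intOf lam) n i := by
    simp only [add_mul _ r]
    rw [Finset.sum_add_distrib, hSi, ← Finset.mul_sum, hTi, hAi0]
    ring
  have hsumj : ∑ k ∈ Finset.range n, (rowContent lam (k + 1) - (k + 1 : ℕ) + (n + 2) + r)
        * (dimRatio (intOf lam) (k + 1) j - dimRatio (intOf lam) k j)
      = (rowContent lam j + 2 + r) * dimRatio (intOf lam) n j := by
    simp only [add_mul _ r]
    rw [Finset.sum_add_distrib, hSj, ← Finset.mul_sum, hTj, hAj0]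
    ring
  have hsum1 : ∑ k ∈ Finset.range n,
      ((rowContent lam (k + 1) - (k + 1 : ℕ) + (n + 2))
          * (rowContent lam (n + 1) - (n + 1 : ℕ) + (n + 2))
        + r * (rowContent lam (n + 1) - (n + 1 : ℕ) + (n + 2))) * gcoef lam i j (k + 1) (n + 1)
      = (rowContent lam (n + 1) + 1)
        * (dimRatio (addBox (intOf lam) i) (n + 1) j - dimRatio (addBox (intOf lam) i) n j)
        * ((rowContent lam i + 2 + r) * dimRatio (intOf lam) n i) := by
    rw [← hsumi, Finset.mul_sum]
    refine Finset.sum_congr rfl fun k hk => ?_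
    rw [hg1 k hk]
    push_cast
    ring
  have hsum2 : ∑ l ∈ Finset.range n,
      ((rowContent lam (n + 1) - (n + 1 : ℕ) + (n + 2))
          * (rowContent lam (l + 1) - (l + 1 : ℕ) + (n + 2))
        + r * (rowContent lam (n + 1) - (n + 1 : ℕ) + (n + 2))) * gcoef lam i j (n + 1) (l + 1)
      = (rowContent lam (n + 1) + 1) * ((1 - r ^ 2)
        * (dimRatio (addBox (intOf lam) j) (n + 1) i - dimRatio (addBox (intOf lam) j) n i))
        * ((rowContent lam j + 2 + r) * dimRatio (intOf lam) n j)
        + (rowContent lam (n + 1) + 1) * (r ^ 2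
        * (dimRatio (addBox (intOf lam) i) (n + 1) j - dimRatio (addBox (intOf lam) i) n j))
        * ((rowContent lam i + 2 + r) * dimRatio (intOf lam) n i) := by
    rw [← hsumi, ← hsumj, Finset.mul_sum, Finset.mul_sum, ← Finset.sum_add_distrib]
    refine Finset.sum_congr rfl fun l hl => ?_
    rw [hg2 l hl]
    push_cast
    ring
  rw [hsum1, hsum2, hg3]
  clear hsum1 hsum2 hsumi hsumj hg1 hg2 hg3 hSi hSj hTi hTj hFge hFle hAi hAj hR hE hy
  push_cast
  generalize dimRatio (intOf lam) n i = P at *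
  generalize dimRatio (intOf lam) n j = Q at *
  generalize dimRatio (intOf lam) (n + 1) i = P' at *
  generalize dimRatio (intOf lam) (n + 1) j = Q' at *
  generalize dimRatio (addBox (intOf lam) i) n j = B at *
  generalize dimRatio (addBox (intOf lam) i) (n + 1) j = B' at *
  generalize dimRatio (addBox (intOf lam) j) n i = E at *
  generalize dimRatio (addBox (intOf lam) j) (n + 1) i = E' at *
  have hM : (rowContent lam i - rowContent lam (n + 1) + 1) * (P * B')
      = (rowContent lam i - rowContent lam (n + 1)) * Rd := by
    linear_combination (rowContent lam i - rowContent lam (n + 1)) * hRd - B' * hAin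
  have hN : (rowContent lam j - rowContent lam (n + 1) + 1) * ((1 - r ^ 2) * (Q * E'))
      = (1 - r ^ 2) * (rowContent lam j - rowContent lam (n + 1)) * Rd := by
    linear_combination (rowContent lam j - rowContent lam (n + 1)) * hEd - (1 - r ^ 2) * E' * hAjn
  suffices hmain : (rowContent lam (n + 1) + 1)
      * ((P * B' - Rn) * (rowContent lam i + 2 + r) * (1 + r ^ 2)
      + ((1 - r ^ 2) * (Q * E') - (1 - r ^ 2) * Rn) * (rowContent lam j + 2 + r)
      + (rowContent lam (n + 1) + 1 + r)
        * (Rd - (1 + r ^ 2) * (P * B') - (1 - r ^ 2) * (Q * E') + Rn))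
      = (rowContent lam i + 1) * (rowContent lam j + (if i = j then 1 else 0) + 1) * Rd
        - (rowContent lam i + 2) * (rowContent lam j + (if i = j then 1 else 0) + 2) * Rn by
    linear_combination hmain
      - (rowContent lam (n + 1) + 1) * (rowContent lam i + 2 + r) * (1 + r ^ 2) * hRn
      - (rowContent lam (n + 1) + 1) * (rowContent lam j + 2 + r) * hEn
  have hRstep : i ≤ n → j ≤ n → Rd * (rowContent lam i - rowContent lam (n + 1))
      * (rowContent lam j + (if i = j then 1 else 0) - rowContent lam (n + 1))
      = Rn * (rowContent lam i - rowContent lam (n + 1) + 1)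
      * (rowContent lam j + (if i = j then 1 else 0) - rowContent lam (n + 1) + 1) := by
    intro hin hjn
    have := hB hin hjn
    rw [← hRn, ← hRd]
    generalize (if i = j then (1 : ℚ) else 0) = δ at *
    linear_combination (B' * (rowContent lam j + δ - rowContent lam (n + 1))) * hAin
      + (P * (rowContent lam i - rowContent lam (n + 1) + 1)) * this
  have hxi := hx i hi.1
  have hxj := hx j hj.1
  clear hx hB hRd hEd hEn hAin hAjn hAi0 hAj0
  generalize hM' : P * B' = M at *
  generalize hN' : (1 - r ^ 2) * (Q * E') = N at *
  rw [hDel] at hr hDel0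
  clear hDel hr2 hC
  by_cases hij : i = j
  · subst hij
    simp only [if_true, sub_self, zero_add, div_one] at hr hDel0 hRstep ⊢
    subst hr
    have hN0 : N = 0 := by rw [← hN']; ring
    subst hN0
    by_cases hin : i ≤ n
    · have h1 := hxi hin
      have h2 := hRstep hin hin
      generalize rowContent lam i = x at *
      generalize rowContent lam (n + 1) = z at *
      have hx : x - z + 1 ≠ 0 := by linarith
      have hx' : x + 1 - z + 1 ≠ 0 := by linarith
      obtain rfl : M = (x - z) * Rd / (x - z + 1) := by field_simp; linear_combination hM
      obtain rfl : Rn = Rd * (x - z) * (x + 1 - z) / ((x - z + 1) * (x + 1 - z + 1)) := by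
        field_simp
        linear_combination -h2
      field_simp
      ring
    · obtain rfl : i = n + 1 := by omega
      rw [hAi_lt (by omega), zero_mul] at hM' hRn
      subst hM' hRn
      ring
  · simp only [if_neg hij, add_zero] at hr hDel0 hRstep ⊢
    by_cases hin : i ≤ n <;> by_cases hjn : j ≤ n
    · have h1 := hxi hin
      have h2 := hxj hjn
      have h3 := hRstep hin hjn
      generalize rowContent lam i = x at *
      generalize rowContent lam j = y at *
      generalize rowContent lam (n + 1) = z at *
      have hx : x - z + 1 ≠ 0 := by linarith
      have hy : y - z + 1 ≠ 0 := by linarith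
      subst hr
      obtain rfl : M = (x - z) * Rd / (x - z + 1) := by field_simp; linear_combination hM
      obtain rfl : N = (1 - (1 / (y - x)) ^ 2) * (y - z) * Rd / (y - z + 1) := by
        rw [eq_div_iff hy]; linear_combination hN
      obtain rfl : Rn = Rd * (x - z) * (y - z) / ((x - z + 1) * (y - z + 1)) := by
        field_simp
        linear_combination -h3
      field_simp
      ring
    · obtain rfl : j = n + 1 := by omega
      rw [hAj_lt (by omega), zero_mul, mul_zero] at hN'
      rw [hB_lt (by omega), mul_zero] at hRn
      have h1 := hxi hin
      subst hN' hRn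
      generalize rowContent lam i = x at *
      generalize rowContent lam (n + 1) = z at *
      have hx : x - z + 1 ≠ 0 := by linarith
      subst hr
      obtain rfl : M = (x - z) * Rd / (x - z + 1) := by field_simp; linear_combination hM
      field_simp
      ring
    · obtain rfl : i = n + 1 := by omega
      rw [hAi_lt (by omega), zero_mul] at hM' hRn
      have h1 := hxj hjn
      subst hM' hRn
      generalize rowContent lam j = y at *
      generalize rowContent lam (n + 1) = z at *
      have hy : y - z + 1 ≠ 0 := by linarith
      subst hr
      obtain rfl : N = (1 - (1 / (y - z)) ^ 2) * (y - z) * Rd / (y - z + 1) := by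
        rw [eq_div_iff hy]; linear_combination hN
      field_simp
      ring
    · omega
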